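/- Let f : ℝ^d → {1,…,K} be Borel measurable, σ > 0, x_1,…,x_K ∈ ℝ^d, δ : ℝ^d → ℝ^d a trigger map, t ∈ {1,…,K} a target class, a ∈ ℝ, and Δ ≥ 0. If for every k ∈ {1,…,K} one has R(x_k) = P_{ε~N(0,σ²I_d)}(f(δ(x_k) + ε) = t) ≥ 1 − Φ(a) and ‖δ(x_k) − x_k‖₂ ≤ Δ, then the local dominant probability s of f at x_1,…,x_K satisfies s ≥ 1 − Φ(a + Δ/σ). -/

import Mathlib

open MeasureTheory ProbabilityTheory

/-- The isotropic Gaussian measure `N(x, σ²I_d)` on `ℝ^d`, as the `d`-fold product of the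
one-dimensional Gaussians `N(xᵢ, σ²)`. -/
noncomputable def gaussPi (d : ℕ) (x : Fin d → ℝ) (σ : ℝ) : Measure (Fin d → ℝ) :=
  Measure.pi fun i => gaussianReal (x i) ((σ ^ 2).toNNReal)

/-- The standard normal CDF `Φ`. -/
noncomputable def stdPhi (a : ℝ) : ℝ := ((gaussianReal 0 1) (Set.Iic a)).toReal

/-- The `k`-th entry of the samplewise local probability vector (SLPV) of the classifier `f`
at `x`: `p_k(x|σ) = P_{ε~N(0,σ²I_d)}(f(x+ε) = k)`. -/
noncomputable def slpv {d K : ℕ} (f : (Fin d → ℝ) → Fin K) (σ : ℝ)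
    (x : Fin d → ℝ) (k : Fin K) : ℝ :=
  ((gaussPi d 0 σ) {ε | f (x + ε) = k}).toReal

/-- The local dominant probability (LDP) of `f` at points `x 0, …, x (K-1)`:
`s = max_k (1/K) Σ_j p_k(x_j|σ)`. -/
noncomputable def ldp {d K : ℕ} (f : (Fin d → ℝ) → Fin K) (σ : ℝ)
    (x : Fin K → Fin d → ℝ) : ℝ :=
  ⨆ k : Fin K, (1 / (K : ℝ)) * ∑ j : Fin K, slpv f σ (x j) k

open scoped NNReal ENNReal

/-- **Neyman–Pearson lemma**: among the sets of at least a given measure under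
`μ.withDensity L`, the superlevel sets of `L` minimise `μ`. -/
lemma measure_le_of_withDensity_le {α : Type*} [MeasurableSpace α] {μ : Measure α}
    [IsFiniteMeasure μ] {L : α → ℝ≥0∞} [IsFiniteMeasure (μ.withDensity L)] {c : ℝ≥0∞}
    (hc0 : c ≠ 0) (hc : c ≠ ∞) {H A : Set α} (hH : MeasurableSet H) (hA : MeasurableSet A)
    (hle : ∀ y ∉ H, L y ≤ c) (hge : ∀ y ∈ H, c ≤ L y)
    (h : μ.withDensity L H ≤ μ.withDensity L A) : μ H ≤ μ A := by
  have h_diff : μ.withDensity L (H \ A) ≤ μ.withDensity L (A \ H) := by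
    rw [← measure_inter_add_sdiff H hA, ← measure_inter_add_sdiff A hH, Set.inter_comm A H] at h
    exact (ENNReal.add_le_add_iff_left (measure_ne_top _ _)).1 h
  have h_lower : c * μ (H \ A) ≤ μ.withDensity L (H \ A) := by
    rw [withDensity_apply _ (hH.diff hA), ← setLIntegral_const]
    exact setLIntegral_mono' (hH.diff hA) fun y hy ↦ hge y hy.1
  have h_upper : μ.withDensity L (A \ H) ≤ c * μ (A \ H) := by
    rw [withDensity_apply _ (hA.diff hH), ← setLIntegral_const]
    exact setLIntegral_mono' (hA.diff hH) fun y hy ↦ hle y hy.2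
  rw [← measure_inter_add_sdiff H hA, ← measure_inter_add_sdiff A hH, Set.inter_comm A H]
  refine add_le_add_right ?_ _
  exact (ENNReal.mul_le_mul_iff_right hc0 hc).1 (h_lower.trans (h_diff.trans h_upper))

lemma pi_withDensity {ι : Type*} [Fintype ι] {X : ι → Type*} [∀ i, MeasurableSpace (X i)]
    (μ : ∀ i, Measure (X i)) [∀ i, IsProbabilityMeasure (μ i)] {g : ∀ i, X i → ℝ≥0∞}
    (hg : ∀ i, Measurable (g i)) [∀ i, SigmaFinite ((μ i).withDensity (g i))] :
    Measure.pi (fun i ↦ (μ i).withDensity (g i)) =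
      (Measure.pi μ).withDensity fun y ↦ ∏ i, g i (y i) := by
  refine Measure.pi_eq fun s hs ↦ ?_
  have h_ind : (Set.univ.pi s).indicator (fun y : ∀ i, X i ↦ ∏ i, g i (y i)) =
      fun y ↦ ∏ i, (s i).indicator (g i) (y i) := by
    ext y
    by_cases hy : y ∈ Set.univ.pi s
    · rw [Set.indicator_of_mem hy]
      exact Finset.prod_congr rfl fun i _ ↦ (Set.indicator_of_mem (hy i trivial) _).symm
    · rw [Set.indicator_of_notMem hy]
      obtain ⟨i, hi⟩ : ∃ i, y i ∉ s i := by simpa [Set.mem_pi] using hy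
      exact (Finset.prod_eq_zero (Finset.mem_univ i) (Set.indicator_of_notMem hi _)).symm
  have h_meas i : Measurable ((s i).indicator (g i)) := (hg i).indicator (hs i)
  rw [withDensity_apply _ (MeasurableSet.univ_pi hs),
    ← lintegral_indicator (MeasurableSet.univ_pi hs), h_ind,
    lintegral_prod_eq_prod_lintegral_of_indepFun Finset.univ
      (fun i (y : ∀ i, X i) ↦ (s i).indicator (g i) (y i))
      (iIndepFun_pi fun i ↦ (h_meas i).aemeasurable)
      fun i ↦ (h_meas i).comp (measurable_pi_apply i)]
  refine Finset.prod_congr rfl fun i _ ↦ ?_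
  rw [(measurePreserving_eval μ i).lintegral_comp (h_meas i), lintegral_indicator (hs i),
    withDensity_apply _ (hs i)]

lemma gaussianReal_eq_withDensity_gaussianReal_zero (m : ℝ) {w : ℝ≥0} (hw : w ≠ 0) :
    gaussianReal m w = (gaussianReal 0 w).withDensity
      fun y ↦ ENNReal.ofReal (Real.exp ((m * y - m ^ 2 / 2) / w)) := by
  rw [gaussianReal_of_var_ne_zero _ hw, gaussianReal_of_var_ne_zero _ hw,
    ← withDensity_mul _ (measurable_gaussianPDF _ _) (by fun_prop)]
  congr 1
  ext y
  rw [Pi.mul_apply, gaussianPDF, gaussianPDF,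
    ← ENNReal.ofReal_mul (gaussianPDFReal_nonneg _ _ _), gaussianPDFReal, gaussianPDFReal,
    mul_assoc _ (Real.exp _) (Real.exp _), ← Real.exp_add]
  have hw' : (w : ℝ) ≠ 0 := by exact_mod_cast hw
  congr 3
  field_simp
  ring

lemma pi_gaussianReal_eq_withDensity {ι : Type*} [Fintype ι] (v : ι → ℝ) {w : ℝ≥0}
    (hw : w ≠ 0) :
    Measure.pi (fun i ↦ gaussianReal (v i) w) =
      (Measure.pi fun _ : ι ↦ gaussianReal 0 w).withDensity
        fun y ↦ ENNReal.ofReal (Real.exp ((∑ i, v i * y i - (∑ i, v i ^ 2) / 2) / w)) := by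
  have h i := gaussianReal_eq_withDensity_gaussianReal_zero (v i) hw
  have h_fin i : SigmaFinite ((gaussianReal 0 w).withDensity
      fun y ↦ ENNReal.ofReal (Real.exp ((v i * y - v i ^ 2 / 2) / w))) := by
    rw [← h i]; infer_instance
  simp_rw [h]
  rw [pi_withDensity (fun _ ↦ gaussianReal 0 w) fun i ↦ by fun_prop]
  congr 1
  ext y
  rw [← ENNReal.ofReal_prod_of_nonneg fun i _ ↦ (Real.exp_pos _).le, ← Real.exp_sum,
    ← Finset.sum_div, Finset.sum_sub_distrib, Finset.sum_div]

lemma map_sum_mul_pi_gaussianReal {ι : Type*} [Fintype ι] (m v : ι → ℝ) (w : ℝ≥0) :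
    (Measure.pi fun i ↦ gaussianReal (m i) w).map (fun y ↦ ∑ i, v i * y i) =
      gaussianReal (∑ i, v i * m i) ((∑ i, v i ^ 2).toNNReal * w) := by
  have h_prob : IsProbabilityMeasure
      ((Measure.pi fun i ↦ gaussianReal (m i) w).map (fun y ↦ ∑ i, v i * y i)) :=
    Measure.isProbabilityMeasure_map (Measurable.aemeasurable (by fun_prop))
  refine Measure.ext_of_charFun ?_
  rw [iIndepFun.charFun_map_fun_sum_eq_prod (X := fun i (y : ι → ℝ) ↦ v i * y i)
    (fun i ↦ Measurable.aemeasurable (by fun_prop)) (iIndepFun_pi (X := fun i y ↦ v i * y) fun i ↦ by fun_prop)]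
  ext t
  have h_eval i : charFun ((Measure.pi fun i ↦ gaussianReal (m i) w).map (fun y ↦ v i * y i)) t =
      charFun (gaussianReal (m i) w) (v i * t) := by
    rw [charFun_map_mul_comp (measurable_pi_apply i).aemeasurable]
    congr 2
    exact (measurePreserving_eval _ i).map_eq
  rw [Finset.prod_apply]
  simp_rw [h_eval,
    charFun_gaussianReal, ← Complex.exp_sum]
  have h_nonneg : 0 ≤ ∑ i, v i ^ 2 := Finset.sum_nonneg fun i _ ↦ sq_nonneg _
  rw [NNReal.coe_mul, Real.coe_toNNReal _ h_nonneg]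
  push_cast
  simp_rw [Finset.mul_sum, Finset.sum_mul, Finset.sum_div]
  rw [← Finset.sum_sub_distrib]
  congr 1
  exact Finset.sum_congr rfl fun i _ ↦ by ring

lemma stdPhi_mono : Monotone stdPhi := fun _ _ h ↦ measureReal_mono (Set.Iic_subset_Iic.2 h)

lemma gaussianReal_real_Ioi (m a : ℝ) {s : ℝ} (hs : 0 < s) :
    (gaussianReal m (s ^ 2).toNNReal).real (Set.Ioi (m + s * a)) = 1 - stdPhi a := by
  have h_map : (gaussianReal 0 1).map (fun y ↦ m + s * y) = gaussianReal m (s ^ 2).toNNReal := by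
    rw [show (fun y ↦ m + s * y) = (m + ·) ∘ (s * ·) from rfl,
      ← Measure.map_map (by fun_prop) (by fun_prop), gaussianReal_map_const_mul,
      gaussianReal_map_const_add, mul_zero, zero_add, mul_one]
    congr 1
    exact (Real.toNNReal_of_nonneg (sq_nonneg s)).symm
  have h_pre : (fun y ↦ m + s * y) ⁻¹' Set.Ioi (m + s * a) = (Set.Iic a)ᶜ := by
    ext y
    simp [hs]
  rw [← h_map, map_measureReal_apply (by fun_prop) measurableSet_Ioi, h_pre,
    probReal_compl_eq_one_sub measurableSet_Iic]
  rfl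

lemma gaussPi_halfSpace {d : ℕ} (m v : Fin d → ℝ) {σ : ℝ} (hσ : 0 < σ)
    (hv : 0 < √(∑ i, v i ^ 2)) (b : ℝ) :
    (gaussPi d m σ).real {y | ∑ i, v i * m i + √(∑ i, v i ^ 2) * σ * b < ∑ i, v i * y i} =
      1 - stdPhi b := by
  have h_nonneg : 0 ≤ ∑ i, v i ^ 2 := Finset.sum_nonneg fun i _ ↦ sq_nonneg _
  rw [← gaussianReal_real_Ioi (∑ i, v i * m i) b (mul_pos hv hσ), mul_pow,
    Real.sq_sqrt h_nonneg, Real.toNNReal_mul h_nonneg, ← map_sum_mul_pi_gaussianReal,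
    map_measureReal_apply (by fun_prop) measurableSet_Ioi]
  rfl

instance (d : ℕ) (m : Fin d → ℝ) (σ : ℝ) : IsProbabilityMeasure (gaussPi d m σ) := by
  unfold gaussPi
  infer_instance

lemma gaussPi_zero_map_const_add {d : ℕ} (v : Fin d → ℝ) (σ : ℝ) :
    (gaussPi d 0 σ).map (v + ·) = gaussPi d v σ := by
  unfold gaussPi
  rw [show (v + ·) = fun (y : Fin d → ℝ) i ↦ v i + y i from rfl,
    Measure.pi_map_pi fun i ↦ by fun_prop]
  simp [gaussianReal_map_const_add]

lemma one_sub_stdPhi_le_gaussPi_zero {d : ℕ} {v : Fin d → ℝ} {σ : ℝ} (hσ : 0 < σ) {a : ℝ}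
    {A : Set (Fin d → ℝ)} (hA : MeasurableSet A)
    (h : 1 - stdPhi a ≤ (gaussPi d v σ).real A) :
    1 - stdPhi (a + √(∑ i, v i ^ 2) / σ) ≤ (gaussPi d 0 σ).real A := by
  have h_nonneg : 0 ≤ ∑ i, v i ^ 2 := Finset.sum_nonneg fun i _ ↦ sq_nonneg _
  rcases (Real.sqrt_nonneg (∑ i, v i ^ 2)).eq_or_lt with hv | hv
  · have hv0 : v = 0 := by
      rw [eq_comm, Real.sqrt_eq_zero h_nonneg,
        Finset.sum_eq_zero_iff_of_nonneg fun i _ ↦ sq_nonneg _] at hv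
      ext i
      simpa using hv i (Finset.mem_univ i)
    subst hv0
    simpa using h
  set n := √(∑ i, v i ^ 2) with hn
  have hn2 : ∑ i, v i * v i = n ^ 2 := by
    rw [hn, Real.sq_sqrt h_nonneg]
    exact Finset.sum_congr rfl fun i _ ↦ (sq _).symm
  set H : Set (Fin d → ℝ) := {y | n ^ 2 + n * σ * a < ∑ i, v i * y i} with hH
  have hH_meas : MeasurableSet H := measurableSet_lt (by fun_prop) (by fun_prop)
  have hQH : (gaussPi d v σ).real H = 1 - stdPhi a := by
    rw [← gaussPi_halfSpace v v hσ hv a, hn2]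
  have hPH : (gaussPi d 0 σ).real H = 1 - stdPhi (a + n / σ) := by
    rw [← gaussPi_halfSpace 0 v hσ hv (a + n / σ), hH]
    congr! 4
    simp only [Pi.zero_apply, mul_zero, Finset.sum_const_zero, zero_add]
    field_simp
    ring
  have hw : (σ ^ 2).toNNReal ≠ 0 := (Real.toNNReal_pos.2 (pow_pos hσ 2)).ne'
  have h_dens := pi_gaussianReal_eq_withDensity v hw
  change gaussPi d v σ = (gaussPi d 0 σ).withDensity _ at h_dens
  rw [← hPH]
  rw [← hQH, h_dens] at h
  have h_fin : IsFiniteMeasure ((gaussPi d 0 σ).withDensity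
      fun y ↦ ENNReal.ofReal (Real.exp
        ((∑ i, v i * y i - (∑ i, v i ^ 2) / 2) / (σ ^ 2).toNNReal))) := by
    rw [← h_dens]; infer_instance
  refine ENNReal.toReal_mono (measure_ne_top _ _) (measure_le_of_withDensity_le
    (c := ENNReal.ofReal (Real.exp
      ((n ^ 2 + n * σ * a - (∑ i, v i ^ 2) / 2) / (σ ^ 2).toNNReal)))
    (ENNReal.ofReal_pos.2 (Real.exp_pos _)).ne' ENNReal.ofReal_ne_top hH_meas hA
    (fun y hy ↦ ?_) (fun y hy ↦ ?_)
    ((ENNReal.toReal_le_toReal (measure_ne_top _ _) (measure_ne_top _ _)).1 h))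
  · have : ∑ i, v i * y i ≤ n ^ 2 + n * σ * a := not_lt.1 hy
    gcongr
  · have : n ^ 2 + n * σ * a < ∑ i, v i * y i := hy
    gcongr

lemma slpv_eq_gaussPi {d K : ℕ} {f : (Fin d → ℝ) → Fin K} (hf : Measurable f) (σ : ℝ)
    (x v : Fin d → ℝ) (k : Fin K) :
    slpv f σ (x + v) k = (gaussPi d v σ).real {ε | f (x + ε) = k} := by
  have h_meas : MeasurableSet {ε | f (x + ε) = k} :=
    (hf.comp (measurable_const_add x)) (measurableSet_singleton k)
  rw [← gaussPi_zero_map_const_add, map_measureReal_apply (by fun_prop) h_meas]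
  simp only [slpv, add_assoc]
  rfl

lemma one_sub_stdPhi_le_slpv {d K : ℕ} {f : (Fin d → ℝ) → Fin K} (hf : Measurable f)
    {σ : ℝ} (hσ : 0 < σ) {x z : Fin d → ℝ} {k : Fin K} {a Δ : ℝ}
    (h : 1 - stdPhi a ≤ slpv f σ z k) (hxz : √(∑ i, (z i - x i) ^ 2) ≤ Δ) :
    1 - stdPhi (a + Δ / σ) ≤ slpv f σ x k := by
  have h_meas : MeasurableSet {ε | f (x + ε) = k} :=
    (hf.comp (measurable_const_add x)) (measurableSet_singleton k)
  rw [← add_sub_cancel x z, slpv_eq_gaussPi hf] at h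
  refine le_trans (sub_le_sub_left (stdPhi_mono ?_) 1) (one_sub_stdPhi_le_gaussPi_zero hσ h_meas h)
  simp only [Pi.sub_apply]
  gcongr

/-- If every samplewise trigger robustness `R(x_k) = P(f(δ(x_k)+ε) = t)` is at least `1 − Φ(a)`
and every trigger perturbation `‖δ(x_k) − x_k‖₂` is at most `Δ`, then the local dominant
probability of `f` at `x_1, …, x_K` is at least `1 − Φ(a + Δ/σ)`. -/
theorem ldp_lower_bound
    (d K : ℕ) (hd : 1 ≤ d) (hK : 1 ≤ K) (f : (Fin d → ℝ) → Fin K) (hf : Measurable f)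
    (σ : ℝ) (hσ : 0 < σ) (x : Fin K → Fin d → ℝ)
    (δ : (Fin d → ℝ) → Fin d → ℝ) (t : Fin K) (a : ℝ) (Δ : ℝ) (hΔ : 0 ≤ Δ)
    (hSTR : ∀ k : Fin K, slpv f σ (δ (x k)) t ≥ 1 - stdPhi a)
    (hpert : ∀ k : Fin K, Real.sqrt (∑ i, (δ (x k) i - x k i) ^ 2) ≤ Δ) :
    ldp f σ x ≥ 1 - stdPhi (a + Δ / σ) := by
  have hK' : (0 : ℝ) < K := by exact_mod_cast hK
  have h_sum : (K : ℝ) * (1 - stdPhi (a + Δ / σ)) ≤ ∑ j : Fin K, slpv f σ (x j) t := by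
    simpa using Finset.card_nsmul_le_sum Finset.univ (fun j ↦ slpv f σ (x j) t) _
      fun j _ ↦ one_sub_stdPhi_le_slpv hf hσ (hSTR j) (hpert j)
  refine le_ciSup_of_le (Set.finite_range _).bddAbove t ?_
  rw [one_div, ← div_eq_inv_mul, le_div_iff₀' hK']
  exact h_sum
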